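/- arXiv:2408.12147 — 2 statements merged into one kernel-verified Lean document; each statement's English description precedes it below -/
import Mathlib

section
/- Let X be a quasi metric space and let m_X ∈ [0, ∞] be the infimum of d(x_0,x_1) + d(x_1,x_2) + d(x_2,x_3) over all 4-cuts (x_0, x_1, x_2, x_3) in X. Let (x_0, …, x_n) ∈ X^{n+1} be a tuple with d(x_i, x_{i+1}) < ∞ for all i and 0 < Σ_{i=0}^{n−1} d(x_i, x_{i+1}) < m_X. Then (x_0, …, x_n) is a thin frame if and only if it satisfies all of: x_0 ≠ x_1; ¬(x_{i−1} ≤ x_i ≤ x_{i+1}) for all 1 ≤ i ≤ n−1; x_0 ≤ a ≤ x_1 implies a = x_0 or a = x_1; and for all 1 ≤ i ≤ n−1, x_i ≤ a ≤ x_{i+1} and a ≠ x_{i+1} imply x_{i−1} ≤ x_i ≤ a. -/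
open scoped ENNReal NNReal

attribute [local instance] Classical.propDecidable

/-- A quasi metric space: `d x y = 0 ↔ x = y` and the triangle inequality;
infinite values and non-symmetry are allowed. -/
structure QuasiMetric (X : Type) : Type where
  d : X → X → ℝ≥0∞
  d_eq_zero_iff : ∀ x y : X, d x y = 0 ↔ x = y
  triangle : ∀ x y z : X, d x z ≤ d x y + d y z

namespace QuasiMetric

variable {X : Type} (q : QuasiMetric X)

/-- `q.Btw x y z` means `x ≤ y ≤ z`, i.e. `d x y + d y z = d x z`. -/
def Btw (x y z : X) : Prop := q.d x y + q.d y z = q.d x z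

/-- A quasi metric space is geodetic if each interval `I(a,b)` (with `d a b < ∞`)
is totally ordered by `x ⪯ y ↔ a ≤ x ≤ y`. -/
def Geodetic : Prop :=
  ∀ a b x y : X, q.d a b ≠ ∞ → q.Btw a x b → q.Btw a y b →
    q.Btw a x y ∨ q.Btw a y x

/-- The length of a tuple `(x_0, …, x_n)`. -/
noncomputable def len {n : ℕ} (t : Fin (n + 1) → X) : ℝ≥0∞ :=
  ∑ i : Fin n, q.d (t i.castSucc) (t i.succ)

end QuasiMetric

/-- The `n`-th magnitude chain group: the free abelian group on all `(n+1)`-tuples.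
(The magnitude chain complex itself lives on the submodules spanned by tuples with
finite consecutive distances; see `QuasiMetric.grMC` below.) -/
abbrev MC (X : Type) (n : ℕ) : Type := (Fin (n + 1) → X) →₀ ℤ

namespace QuasiMetric

variable {X : Type} (q : QuasiMetric X)

/-- The condition under which the `i`-th entry of a tuple `(x_0, …, x_{n+1})` is deleted by
the boundary operator: `x_{i-1} ≤ x_i ≤ x_{i+1}` with the conventions `x_{-1} = x_1` and
`x_{n+2} = x_n`. -/
def delCond {n : ℕ} (t : Fin (n + 2) → X) (i : Fin (n + 2)) : Prop :=
  q.Btw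
    (if _ : (i : ℕ) = 0 then t ⟨1, by omega⟩
      else t ⟨(i : ℕ) - 1, by have := i.isLt; omega⟩)
    (t i)
    (if _ : (i : ℕ) = n + 1 then t ⟨n, by omega⟩
      else t ⟨(i : ℕ) + 1, by have := i.isLt; omega⟩)

/-- The boundary operator `∂ = Σ_i (-1)^i ∂_i` of the magnitude chain complex, where
`∂_i` deletes `x_i` when `x_{i-1} ≤ x_i ≤ x_{i+1}` (conventions `x_{-1} = x_1`,
`x_{n+2} = x_n`) and is zero otherwise. -/
noncomputable def bdry (n : ℕ) : MC X (n + 1) →ₗ[ℤ] MC X n :=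
  Finsupp.lift (MC X n) ℤ (Fin (n + 2) → X) fun t =>
    ∑ i : Fin (n + 2),
      if q.delCond t i then ((-1 : ℤ) ^ (i : ℕ)) • Finsupp.single (t ∘ i.succAbove) (1 : ℤ)
      else 0

/-- The degree `n`, length `ℓ` part of the magnitude chain complex: the span of the
tuples of length `ℓ`. (For `ℓ ≠ ∞` all consecutive distances of such tuples are finite.) -/
noncomputable def grMC (n : ℕ) (ℓ : ℝ≥0∞) : Submodule ℤ (MC X n) :=
  Submodule.span ℤ {c | ∃ t : Fin (n + 1) → X, q.len t = ℓ ∧ c = Finsupp.single t 1}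

/-- Cycles of the degree `n`, length `ℓ` part of the magnitude chain complex. -/
noncomputable def grZ (n : ℕ) (ℓ : ℝ≥0∞) : Submodule ℤ (MC X n) :=
  match n with
  | 0 => q.grMC 0 ℓ
  | (m + 1) => q.grMC (m + 1) ℓ ⊓ LinearMap.ker (q.bdry m)

/-- Boundaries of the degree `n`, length `ℓ` part of the magnitude chain complex. -/
noncomputable def grB (n : ℕ) (ℓ : ℝ≥0∞) : Submodule ℤ (MC X n) :=
  Submodule.map (q.bdry n) (q.grMC (n + 1) ℓ)

/-- The magnitude homology `MH_n^ℓ(X)` : cycles modulo boundaries in the degree `n`,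
length `ℓ` part of the magnitude chain complex. -/
abbrev grMH (n : ℕ) (ℓ : ℝ≥0∞) : Type :=
  ↥(q.grZ n ℓ) ⧸ Submodule.comap (q.grZ n ℓ).subtype (q.grB n ℓ)

end QuasiMetric

namespace QuasiMetric

variable {X : Type} (q : QuasiMetric X)

/-- A tuple is saturated if `x_i ≤ a ≤ x_{i+1}` implies `a = x_i` or `a = x_{i+1}`
for all consecutive indices. -/
def Saturated {n : ℕ} (t : Fin (n + 1) → X) : Prop :=
  ∀ (i : Fin n) (a : X),
    q.Btw (t i.castSucc) a (t i.succ) → a = t i.castSucc ∨ a = t i.succ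

/-- A quasi metric space is `n`-diagonal if every homology class in `MH_n^ℓ(X)` is
represented by a `ℤ`-linear combination of saturated tuples, for every `ℓ`. -/
def IsNDiagonal (n : ℕ) : Prop :=
  ∀ (ℓ : ℝ≥0) (z : q.grZ n (ℓ : ℝ≥0∞)),
    ∃ c : q.grZ n (ℓ : ℝ≥0∞),
      (c : MC X n) ∈ Submodule.span ℤ
          {f | ∃ t : Fin (n + 1) → X, q.len t = (ℓ : ℝ≥0∞) ∧ q.Saturated t ∧
            f = Finsupp.single t 1} ∧
      (Submodule.Quotient.mk c : q.grMH n (ℓ : ℝ≥0∞)) = Submodule.Quotient.mk z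

/-- A quasi metric space is diagonal if it is `n`-diagonal for every `n ≥ 0`. -/
def Diagonal : Prop := ∀ n : ℕ, q.IsNDiagonal n

/-- `(x0, x1, x2, x3)` is a 4-cut: consecutive distances are finite,
`x0 ≤ x1 ≤ x2`, `x1 ≤ x2 ≤ x3`, `x1 ≠ x2` and `¬(x0 ≤ x1 ≤ x3)`. -/
def FourCut (x0 x1 x2 x3 : X) : Prop :=
  q.d x0 x1 ≠ ∞ ∧ q.d x1 x2 ≠ ∞ ∧ q.d x2 x3 ≠ ∞ ∧
  q.Btw x0 x1 x2 ∧ q.Btw x1 x2 x3 ∧ x1 ≠ x2 ∧ ¬ q.Btw x0 x1 x3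

end QuasiMetric

namespace QuasiMetric

variable {X : Type} (q : QuasiMetric X)

/-- `m_X`: the infimum of `d(x0,x1) + d(x1,x2) + d(x2,x3)` over all 4-cuts
`(x0,x1,x2,x3)` of `X` (equal to `∞` if there are none). -/
noncomputable def mX : ℝ≥0∞ :=
  sInf {l | ∃ x0 x1 x2 x3 : X,
    q.FourCut x0 x1 x2 x3 ∧ l = q.d x0 x1 + q.d x1 x2 + q.d x2 x3}

/-- A tuple `(x_0, …, x_{n+1})` is a thin frame if `¬(x_{i-1} ≤ x_i ≤ x_{i+1})` for all
interior indices, and `x_i ≤ a ≤ x_{i+1}` implies `a = x_i` or `a = x_{i+1}`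
for all consecutive indices. -/
def ThinFrame {n : ℕ} (t : Fin (n + 2) → X) : Prop :=
  (∀ (i : ℕ) (h1 : 1 ≤ i) (h2 : i ≤ n),
    ¬ q.Btw (t ⟨i - 1, by omega⟩) (t ⟨i, by omega⟩) (t ⟨i + 1, by omega⟩)) ∧
  (∀ (i : Fin (n + 1)) (a : X),
    q.Btw (t i.castSucc) a (t i.succ) → a = t i.castSucc ∨ a = t i.succ)

end QuasiMetric

namespace QuasiMetric

variable {X : Type} (q : QuasiMetric X)

theorem btw_self_left (x y : X) : q.Btw x x y := by
  simp [Btw, (q.d_eq_zero_iff x x).2 rfl]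

theorem btw_self_right (x y : X) : q.Btw x y y := by
  simp [Btw, (q.d_eq_zero_iff y y).2 rfl]

/-- Two consecutive steps of a tuple contribute at most its total length. -/
theorem d_add_d_le_len {n : ℕ} (t : Fin (n + 1) → X) {i j : Fin n} (hij : i ≠ j) :
    q.d (t i.castSucc) (t i.succ) + q.d (t j.castSucc) (t j.succ) ≤ q.len t := by
  rw [len, ← Finset.sum_pair (f := fun k : Fin n => q.d (t k.castSucc) (t k.succ)) hij]
  exact Finset.sum_le_sum_of_subset (Finset.subset_univ _)

theorem mX_le_of_fourCut {x y a z : X} (h : q.FourCut x y a z) :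
    q.mX ≤ q.d x y + q.d y z := by
  have hb : q.d y a + q.d a z = q.d y z := h.2.2.2.2.1
  rw [← hb, ← add_assoc]
  exact sInf_le ⟨x, y, a, z, h, rfl⟩

/-- Below length `m_X`, betweenness extends from a point of an interval to its endpoint. -/
theorem btw_of_lt_mX {x y a z : X} (hxy : q.d x y ≠ ∞) (hyz : q.d y z ≠ ∞)
    (hlt : q.d x y + q.d y z < q.mX) (hya : y ≠ a) (hxya : q.Btw x y a)
    (hyaz : q.Btw y a z) : q.Btw x y z := by
  by_contra hn
  have hfin : q.d y a + q.d a z ≠ ∞ := hyaz.trans_ne hyz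
  rw [ENNReal.add_ne_top] at hfin
  exact hlt.not_ge
    (q.mX_le_of_fourCut ⟨hxy, hfin.1, hfin.2, hxya, hyaz, hya, hn⟩)

end QuasiMetric

/-- Let `X` be a quasi metric space and `(x_0, …, x_{n+1})` a tuple with
finite consecutive distances and total length strictly between `0` and `m_X`. Then the
tuple is a thin frame if and only if: `x_0 ≠ x_1`; `¬(x_{i-1} ≤ x_i ≤ x_{i+1})` for all
interior indices; `x_0 ≤ a ≤ x_1` implies `a = x_0` or `a = x_1`; and for interior `i`,
`x_i ≤ a ≤ x_{i+1}` and `a ≠ x_{i+1}` imply `x_{i-1} ≤ x_i ≤ a`. -/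
theorem thinFrame_iff_of_len_lt_mX
    {X : Type} (q : QuasiMetric X) (n : ℕ) (t : Fin (n + 2) → X)
    (hfin : ∀ i : Fin (n + 1), q.d (t i.castSucc) (t i.succ) ≠ ∞)
    (hpos : 0 < q.len t) (hlt : q.len t < q.mX) :
    q.ThinFrame t ↔
      (t 0 ≠ t 1 ∧
       (∀ (i : ℕ) (h1 : 1 ≤ i) (h2 : i ≤ n),
         ¬ q.Btw (t ⟨i - 1, by omega⟩) (t ⟨i, by omega⟩) (t ⟨i + 1, by omega⟩)) ∧
       (∀ a : X, q.Btw (t 0) a (t 1) → a = t 0 ∨ a = t 1) ∧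
       (∀ (i : ℕ) (h1 : 1 ≤ i) (h2 : i ≤ n) (a : X),
         q.Btw (t ⟨i, by omega⟩) a (t ⟨i + 1, by omega⟩) → a ≠ t ⟨i + 1, by omega⟩ →
           q.Btw (t ⟨i - 1, by omega⟩) (t ⟨i, by omega⟩) a)) := by
  constructor
  · rintro ⟨hframe, hthin⟩
    refine ⟨fun h01 => ?_, hframe, hthin 0, fun i h1 h2 a ha hne => ?_⟩
    · cases n with
      | zero =>
        have hlen : q.len t = q.d (t 0) (t 1) := by simp [QuasiMetric.len]
        rw [hlen, (q.d_eq_zero_iff _ _).2 h01] at hpos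
        exact hpos.false
      | succ n =>
        refine hframe 1 le_rfl (by omega) ?_
        have h : t ⟨0, by omega⟩ = t ⟨1, by omega⟩ := h01
        change q.Btw (t ⟨0, by omega⟩) (t ⟨1, by omega⟩) (t ⟨2, by omega⟩)
        rw [h]
        exact q.btw_self_left _ _
    · rcases hthin ⟨i, by omega⟩ a ha with rfl | h
      · exact q.btw_self_right _ _
      · exact absurd h hne
  · rintro ⟨-, hframe, hthin, hext⟩
    refine ⟨hframe, fun i a ha => ?_⟩
    obtain ⟨_ | i, hi⟩ := i
    · exact hthin a ha
    · by_contra! hne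
      have hlen := q.d_add_d_le_len t
        (i := (⟨i, by omega⟩ : Fin (n + 1))) (j := ⟨i + 1, hi⟩) (by simp)
      exact hframe (i + 1) (by omega) (by omega)
        (q.btw_of_lt_mX (hfin ⟨i, by omega⟩) (hfin ⟨i + 1, hi⟩) (hlen.trans_lt hlt)
          hne.1.symm (hext (i + 1) (by omega) (by omega) a ha hne.2) ha)
end

section
/- Let X be a finite geodetic quasi metric space. If X is 2-diagonal, then there is no 4-cut (x, y, z, w) in X such that the pair (x, y) is saturated, i.e. such that x ≤ a ≤ y implies a = x or a = y. -/
open scoped ENNReal NNReal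

attribute [local instance] Classical.propDecidable

namespace QuasiMetric

variable {X : Type} (q : QuasiMetric X)

theorem d_self (a : X) : q.d a a = 0 := (q.d_eq_zero_iff a a).2 rfl

theorem btw_left (a b : X) : q.Btw a a b := by simp [Btw, d_self]

theorem btw_right (a b : X) : q.Btw a b b := by simp [Btw, d_self]

theorem btw_self_iff {a b : X} : q.Btw a b a ↔ a = b := by
  constructor
  · intro h
    rw [Btw, d_self, add_eq_zero] at h
    exact (q.d_eq_zero_iff a b).1 h.1
  · rintro rfl
    exact q.btw_left a a

variable {q}

theorem Btw.ne_top_left {a b c : X} (h : q.Btw a b c) (hf : q.d a c ≠ ∞) : q.d a b ≠ ∞ :=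
  (ENNReal.add_ne_top.1 (h.symm ▸ hf : q.d a b + q.d b c ≠ ∞)).1

theorem Btw.ne_top_right {a b c : X} (h : q.Btw a b c) (hf : q.d a c ≠ ∞) : q.d b c ≠ ∞ :=
  (ENNReal.add_ne_top.1 (h.symm ▸ hf : q.d a b + q.d b c ≠ ∞)).2

/-- If `a ≤ b ≤ e` and `b ≤ c ≤ e`, then `a ≤ b ≤ c` and `a ≤ c ≤ e`. -/
theorem Btw.trans_right {a b c e : X} (h₁ : q.Btw a b e) (h₂ : q.Btw b c e)
    (hf : q.d a e ≠ ∞) : q.Btw a b c ∧ q.Btw a c e := by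
  have hbe := h₁.ne_top_right hf
  have hab := h₁.ne_top_left hf
  have hbc := h₂.ne_top_left hbe
  have hce := h₂.ne_top_right hbe
  have t₁ := q.triangle a b c
  have t₂ := q.triangle a c e
  have hac : q.d a c ≠ ∞ := ne_top_of_le_ne_top (ENNReal.add_ne_top.2 ⟨hab, hbc⟩) t₁
  unfold Btw at *
  generalize q.d a b = ab at *
  generalize q.d a c = ac at *
  generalize q.d a e = ae at *
  generalize q.d b c = bc at *
  generalize q.d b e = be at *
  generalize q.d c e = ce at *
  lift ab to ℝ≥0 using hab
  lift ac to ℝ≥0 using hac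
  lift ae to ℝ≥0 using hf
  lift bc to ℝ≥0 using hbc
  lift be to ℝ≥0 using hbe
  lift ce to ℝ≥0 using hce
  norm_cast at *
  constructor <;> apply le_antisymm <;> linarith

/-- If `a ≤ c ≤ e` and `a ≤ b ≤ c`, then `a ≤ b ≤ e` and `b ≤ c ≤ e`. -/
theorem Btw.trans_left {a b c e : X} (h₁ : q.Btw a c e) (h₂ : q.Btw a b c)
    (hf : q.d a e ≠ ∞) : q.Btw a b e ∧ q.Btw b c e := by
  have hce := h₁.ne_top_right hf
  have hac := h₁.ne_top_left hf
  have hab := h₂.ne_top_left hac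
  have hbc := h₂.ne_top_right hac
  have t₁ := q.triangle b c e
  have t₂ := q.triangle a b e
  have hbe : q.d b e ≠ ∞ := ne_top_of_le_ne_top (ENNReal.add_ne_top.2 ⟨hbc, hce⟩) t₁
  unfold Btw at *
  generalize q.d a b = ab at *
  generalize q.d a c = ac at *
  generalize q.d a e = ae at *
  generalize q.d b c = bc at *
  generalize q.d b e = be at *
  generalize q.d c e = ce at *
  lift ab to ℝ≥0 using hab
  lift ac to ℝ≥0 using hac
  lift ae to ℝ≥0 using hf
  lift bc to ℝ≥0 using hbc
  lift be to ℝ≥0 using hbe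
  lift ce to ℝ≥0 using hce
  norm_cast at *
  constructor <;> apply le_antisymm <;> linarith

/-- If `a ≤ b ≤ c` and `a ≤ c ≤ b`, then `b = c`. -/
theorem Btw.antisymm {a b c : X} (h₁ : q.Btw a b c) (h₂ : q.Btw a c b)
    (hf : q.d a c ≠ ∞) : b = c :=
  (q.btw_self_iff.1 (h₁.trans_left h₂ hf).2).symm

theorem Btw.d_lt {a b c : X} (h : q.Btw a b c) (hf : q.d a c ≠ ∞) (hne : b ≠ c) :
    q.d a b < q.d a c := by
  rw [← show q.d a b + q.d b c = q.d a c from h]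
  exact ENNReal.lt_add_right (h.ne_top_left hf) (mt (q.d_eq_zero_iff b c).1 hne)

variable (q)

/-- A 4-cut starting with `x, y` whose last entry is closest to `y` among all such: every
`v ≠ w` of the interval from `y` to `w` satisfies `x ≤ y ≤ v`. -/
theorem exists_minimal_fourCut [Finite X] (hgeo : q.Geodetic) {x y z w : X}
    (h : q.FourCut x y z w) :
    ∃ z w : X, q.FourCut x y z w ∧ ∀ v, q.Btw y v w → v ≠ w → q.Btw x y v := by
  obtain ⟨w, ⟨z, hzw⟩, hmin⟩ := Set.exists_min_image {w | ∃ z, q.FourCut x y z w}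
    (q.d y) (Set.toFinite _) ⟨w, z, h⟩
  refine ⟨z, w, hzw, fun v hv hvw => ?_⟩
  obtain ⟨hxy, hyz, hzwf, hxyz, hyzw, hne, hcut⟩ := hzw
  have hyw : q.d y w ≠ ∞ := by
    rw [← show q.d y z + q.d z w = q.d y w from hyzw]
    exact ENNReal.add_ne_top.2 ⟨hyz, hzwf⟩
  have hxz : q.d x z ≠ ∞ := by
    rw [← show q.d x y + q.d y z = q.d x z from hxyz]
    exact ENNReal.add_ne_top.2 ⟨hxy, hyz⟩
  rcases hgeo y w v z hyw hv hyzw with h' | h'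
  · exact (hxyz.trans_right h' hxz).1
  · by_contra hn
    have hyv := hv.ne_top_left hyw
    exact (hv.d_lt hyw hvw).not_ge
      (hmin v ⟨z, hxy, hyz, h'.ne_top_right hyv, hxyz, h', hne, hn⟩)

theorem bdry_single {n : ℕ} (t : Fin (n + 2) → X) :
    q.bdry n (Finsupp.single t 1) = ∑ i : Fin (n + 2),
      if q.delCond t i then ((-1 : ℤ) ^ (i : ℕ)) • Finsupp.single (t ∘ i.succAbove) (1 : ℤ)
      else 0 := by
  simp [bdry]

theorem len_two (t : Fin 3 → X) : q.len t = q.d (t 0) (t 1) + q.d (t 1) (t 2) := by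
  simp [len, Fin.sum_univ_two]

theorem len_three (t : Fin 4 → X) :
    q.len t = q.d (t 0) (t 1) + q.d (t 1) (t 2) + q.d (t 2) (t 3) := by
  simp [len, Fin.sum_univ_three]

theorem bdry_one_single_eq_zero {x y w : X} (hxy : x ≠ y) (hyw : y ≠ w)
    (h : ¬ q.Btw x y w) : q.bdry 1 (Finsupp.single ![x, y, w] 1) = 0 := by
  have h₀ : ¬ q.delCond ![x, y, w] 0 := fun h' => hxy (q.btw_self_iff.1 h').symm
  have h₁ : ¬ q.delCond ![x, y, w] 1 := h
  have h₂ : ¬ q.delCond ![x, y, w] 2 := fun h' => hyw (q.btw_self_iff.1 h')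
  rw [bdry_single, Fin.sum_univ_three, if_neg h₀, if_neg h₁, if_neg h₂]
  simp

/-- The linear functional on `2`-chains counting the tuples `(x, v, w)` with `y ≤ v ≤ w` and
`v ≠ w`. -/
noncomputable def countMiddle (x y w : X) : MC X 2 →ₗ[ℤ] ℤ :=
  Finsupp.linearCombination ℤ fun t =>
    if t 0 = x ∧ t 2 = w ∧ q.Btw y (t 1) w ∧ t 1 ≠ w then 1 else 0

theorem countMiddle_single (x y w : X) (t : Fin 3 → X) :
    q.countMiddle x y w (Finsupp.single t 1) =
      if t 0 = x ∧ t 2 = w ∧ q.Btw y (t 1) w ∧ t 1 ≠ w then 1 else 0 := by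
  simp [countMiddle]

theorem countMiddle_bdry_single (hgeo : q.Geodetic) {x y w : X} (hxy : x ≠ y)
    (hyw : q.d y w ≠ ∞)
    (hsat : ∀ a, q.Btw x a y → a = x ∨ a = y)
    (hmin : ∀ v, q.Btw y v w → v ≠ w → q.Btw x y v)
    (t : Fin 4 → X) (ht : q.len t ≠ ∞) :
    q.countMiddle x y w (q.bdry 2 (Finsupp.single t 1)) = 0 := by
  have hx : ¬ (q.Btw y x w ∧ x ≠ w) := fun h => hxy (q.btw_self_iff.1 (hmin x h.1 h.2))
  rw [len_three] at ht
  have hmid : t 0 = x → t 3 = w → t 0 ≠ t 1 → t 2 ≠ t 3 →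
      ((q.Btw (t 0) (t 1) (t 2) ∧ q.Btw y (t 2) w) ↔
        (q.Btw (t 1) (t 2) (t 3) ∧ q.Btw y (t 1) w ∧ t 1 ≠ w)) := by
    generalize t 0 = a at *
    generalize t 1 = b at *
    generalize t 2 = c at *
    generalize t 3 = e at *
    rintro rfl rfl hab hce
    obtain ⟨⟨hfab, hfbc⟩, -⟩ := by simpa only [ENNReal.add_ne_top] using ht
    have hfac : q.d a c ≠ ∞ :=
      ne_top_of_le_ne_top (ENNReal.add_ne_top.2 ⟨hfab, hfbc⟩) (q.triangle a b c)
    constructor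
    · rintro ⟨habc, hyce⟩
      have hayc := hmin c hyce hce
      have hayb : q.Btw a y b := by
        rcases hgeo a c b y hfac habc hayc with h | h
        · rcases hsat b h with h | h
          · exact absurd h.symm hab
          · subst h; exact q.btw_right a b
        · exact h
      have hybc := (habc.trans_left hayb hfac).2
      have hb := hyce.trans_left hybc hyw
      refine ⟨hb.2, hb.1, ?_⟩
      rintro rfl
      exact hce (hyce.antisymm hybc hyw)
    · rintro ⟨hbce, hybe, -⟩
      have hc := hybe.trans_right hbce hyw
      exact ⟨((hmin c hc.2 hce).trans_right hc.1 hfac).2, hc.2⟩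
  have h₀ : q.delCond t 0 ↔ t 0 = t 1 :=
    ⟨fun h => (q.btw_self_iff.1 h).symm, fun h => q.btw_self_iff.2 h.symm⟩
  have h₁ : q.delCond t 1 ↔ q.Btw (t 0) (t 1) (t 2) := Iff.rfl
  have h₂ : q.delCond t 2 ↔ q.Btw (t 1) (t 2) (t 3) := Iff.rfl
  have h₃ : q.delCond t 3 ↔ t 2 = t 3 := q.btw_self_iff
  have s₀ : q.countMiddle x y w (Finsupp.single (t ∘ Fin.succAbove 0) 1) =
      if t 1 = x ∧ t 3 = w ∧ q.Btw y (t 2) w ∧ t 2 ≠ w then 1 else 0 :=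
    q.countMiddle_single x y w _
  have s₁ : q.countMiddle x y w (Finsupp.single (t ∘ Fin.succAbove 1) 1) =
      if t 0 = x ∧ t 3 = w ∧ q.Btw y (t 2) w ∧ t 2 ≠ w then 1 else 0 :=
    q.countMiddle_single x y w _
  have s₂ : q.countMiddle x y w (Finsupp.single (t ∘ Fin.succAbove 2) 1) =
      if t 0 = x ∧ t 3 = w ∧ q.Btw y (t 1) w ∧ t 1 ≠ w then 1 else 0 :=
    q.countMiddle_single x y w _
  have s₃ : q.countMiddle x y w (Finsupp.single (t ∘ Fin.succAbove 3) 1) =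
      if t 0 = x ∧ t 2 = w ∧ q.Btw y (t 1) w ∧ t 1 ≠ w then 1 else 0 :=
    q.countMiddle_single x y w _
  rw [bdry_single, Fin.sum_univ_four]
  simp only [map_add, apply_ite (q.countMiddle x y w), map_smul, map_zero, s₀, s₁, s₂, s₃,
    h₀, h₁, h₂, h₃]
  have hl := q.btw_left (t 1) (t 2)
  have hr := q.btw_right (t 1) (t 2)
  clear s₀ s₁ s₂ s₃ h₀ h₁ h₂ h₃ hsat hmin ht hgeo
  generalize t 0 = a at *
  generalize t 1 = b at *
  generalize t 2 = c at *
  generalize t 3 = e at *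
  norm_num
  by_cases hab : a = b
  · subst hab
    have hax : ¬ (a = x ∧ q.Btw y a w ∧ a ≠ w) := by rintro ⟨rfl, h⟩; exact hx h
    grind
  · by_cases hce : c = e
    · subst hce
      grind
    · grind

end QuasiMetric

/-- **Statement 10.** Let `X` be a finite geodetic quasi metric space. If `X` is
2-diagonal then there is no 4-cut `(x, y, z, w)` with `(x, y)` saturated
(i.e. with `x ≤ a ≤ y` implying `a = x` or `a = y`). -/
theorem no_fourCut_with_saturated_pair_of_two_diagonal
    {X : Type} [Fintype X] (q : QuasiMetric X) (hgeo : q.Geodetic)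
    (h2 : q.IsNDiagonal 2) :
    ¬ ∃ x y z w : X, q.FourCut x y z w ∧
      ∀ a : X, q.Btw x a y → a = x ∨ a = y := by
  rintro ⟨x, y, z₀, w₀, hcut₀, hsat⟩
  obtain ⟨z, w, ⟨hfxy, hfyz, hfzw, hxyz, hyzw, hyz, hcut⟩, hmin⟩ :=
    q.exists_minimal_fourCut hgeo hcut₀
  have hfyw : q.d y w ≠ ∞ := by
    rw [← show q.d y z + q.d z w = q.d y w from hyzw]
    exact ENNReal.add_ne_top.2 ⟨hfyz, hfzw⟩
  have hxy : x ≠ y := by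
    rintro rfl
    exact hcut (q.btw_left x w)
  have hyw : y ≠ w := by
    rintro rfl
    exact hcut (q.btw_right x y)
  have hzw : z ≠ w := by
    rintro rfl
    exact hcut hxyz
  have hfl : q.d x y + q.d y w ≠ ∞ := ENNReal.add_ne_top.2 ⟨hfxy, hfyw⟩
  lift q.d x y + q.d y w to ℝ≥0 using hfl with ℓ hℓ
  have hmem : (Finsupp.single ![x, y, w] 1 : MC X 2) ∈ q.grZ 2 (ℓ : ℝ≥0∞) :=
    ⟨Submodule.subset_span ⟨_, by rw [q.len_two, hℓ]; rfl, rfl⟩,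
      q.bdry_one_single_eq_zero hxy hyw hcut⟩
  obtain ⟨c, hc, hcz⟩ := h2 ℓ ⟨_, hmem⟩
  have hB : q.grB 2 (ℓ : ℝ≥0∞) ≤ LinearMap.ker (q.countMiddle x y w) := by
    rw [QuasiMetric.grB, Submodule.map_le_iff_le_comap, QuasiMetric.grMC, Submodule.span_le]
    rintro _ ⟨t, ht, rfl⟩
    exact q.countMiddle_bdry_single hgeo hxy hfyw hsat hmin t (ht ▸ ENNReal.coe_ne_top)
  have hS : (c : MC X 2) ∈ LinearMap.ker (q.countMiddle x y w) := by
    refine Submodule.span_le.2 ?_ hc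
    rintro _ ⟨t, -, ht, rfl⟩
    rw [SetLike.mem_coe, LinearMap.mem_ker, QuasiMetric.countMiddle_single, if_neg]
    rintro ⟨rfl, rfl, hb, hbw⟩
    rcases ht 0 y (hmin _ hb hbw) with h | h
    · exact hxy h.symm
    · subst h
      rcases ht 1 z hyzw with h | h
      · exact hyz h.symm
      · exact hzw h
  have hdiff := hB (Submodule.mem_comap.1 ((Submodule.Quotient.eq _).1 hcz))
  rw [LinearMap.mem_ker] at hS hdiff
  simp only [Submodule.subtype_apply, map_sub, hS,
    QuasiMetric.countMiddle_single] at hdiff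
  simp [q.btw_left, hyw] at hdiff
end
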